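/- Let (X,T) be an aperiodic zero-dimensional topological dynamical system (X a nonempty compact metric space with a basis of clopen sets, T : X → X a homeomorphism with no periodic points). Then there exist a sequence of clopen sets (F_k)_{k≥1} with F_{k+1} ⊆ F_k for all k, and positive integers a_k ≤ b_k with a_k → ∞, such that: (1) for every x ∈ X and every k, the visit set {n ∈ ℤ : Tⁿx ∈ F_k} is unbounded above and unbounded below and any two of its consecutive elements differ by at least a_k and at most b_k; and (2) the set M = {x ∈ X : ∃ n ∈ ℤ, Tⁿx ∈ ⋂_{k≥1} F_k} is meager (of the first Baire category) in X. -/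

import Mathlib

open TopologicalSpace Filter

/-- A topology has a basis of clopen sets (zero-dimensionality). -/
def ZeroDim (X : Type*) [TopologicalSpace X] : Prop :=
  ∃ B : Set (Set X), (∀ s ∈ B, IsClopen s) ∧ IsTopologicalBasis B

/-- Aperiodicity: no periodic points. -/
def Aperiodic' {X : Type*} (T : X ≃ X) : Prop :=
  ∀ (x : X) (n : ℕ), 1 ≤ n → (T ^ n) x ≠ x

/-- For every point, the set of visit times to `F` is unbounded above and below, and
the gaps between consecutive visits lie in `[a, b]`. -/
def MarkerSet {X : Type*} (T : X ≃ X) (F : Set X) (a b : ℕ) : Prop :=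
  ∀ x : X,
    (∀ N : ℤ, ∃ n : ℤ, N < n ∧ (T ^ n) x ∈ F) ∧
    (∀ N : ℤ, ∃ n : ℤ, n < N ∧ (T ^ n) x ∈ F) ∧
    (∀ m n : ℤ, m < n → (T ^ m) x ∈ F → (T ^ n) x ∈ F →
      (∀ j : ℤ, m < j → j < n → (T ^ j) x ∉ F) →
      (a : ℤ) ≤ n - m ∧ n - m ≤ (b : ℤ))

open Topology

section Markers

variable {X : Type*}

/-- Every orbit of `T` visits `F`. -/
def Sweeping (T : X ≃ X) (F : Set X) : Prop :=
  ∀ y : X, ∃ i : ℤ, (T ^ i) y ∈ F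

/-- Distinct visits of an orbit of `T` to `F` are at least `n` apart. -/
def Separated (T : X ≃ X) (n : ℕ) (F : Set X) : Prop :=
  ∀ i : ℤ, i ≠ 0 → |i| < n → ∀ y ∈ F, (T ^ i) y ∉ F

theorem Equiv.zpow_apply_zpow_apply (T : X ≃ X) (i j : ℤ) (y : X) :
    (T ^ i) ((T ^ j) y) = (T ^ (i + j)) y := by
  rw [zpow_add]; rfl

theorem Aperiodic'.zpow_apply_ne {T : X ≃ X} (h : Aperiodic' T) (x : X) {i : ℤ} (hi : i ≠ 0) :
    (T ^ i) x ≠ x := by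
  intro hx
  rcases Int.eq_nat_or_neg i with ⟨n, rfl | rfl⟩
  · exact h x n (by omega) (by simpa using hx)
  · refine h x n (by omega) ?_
    have := T.zpow_apply_zpow_apply n (-n) x
    rw [hx] at this
    simpa using this

theorem Separated.mono {T : X ≃ X} {n : ℕ} {F G : Set X} (h : Separated T n F) (hG : G ⊆ F) :
    Separated T n G :=
  fun i hi hin y hy hy' => h i hi hin y (hG hy) (hG hy')

variable [TopologicalSpace X]

theorem Homeomorph.continuous_toEquiv_zpow (T : X ≃ₜ X) (i : ℤ) :
    Continuous ⇑(T.toEquiv ^ i) := by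
  induction i using Int.induction_on with
  | zero => simpa using continuous_id
  | succ n ih =>
    rw [zpow_add_one]
    exact ih.comp T.continuous
  | pred n ih =>
    rw [zpow_sub_one]
    exact ih.comp T.symm.continuous

theorem Sweeping.exists_bound [CompactSpace X] {T : X ≃ₜ X} {F : Set X}
    (h : Sweeping T.toEquiv F) (hF : IsOpen F) :
    ∃ N : ℕ, ∀ y, ∃ i : ℤ, |i| ≤ N ∧ (T.toEquiv ^ i) y ∈ F := by
  obtain ⟨t, ht⟩ := isCompact_univ.elim_finite_subcover
    (fun i : ℤ => ⇑(T.toEquiv ^ i) ⁻¹' F)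
    (fun i => hF.preimage (T.continuous_toEquiv_zpow i))
    (fun y _ => Set.mem_iUnion.2 (h y))
  refine ⟨t.sup Int.natAbs, fun y => ?_⟩
  obtain ⟨i, hi, hy⟩ := Set.mem_iUnion₂.1 (ht (Set.mem_univ y))
  refine ⟨i, ?_, hy⟩
  rw [Int.abs_eq_natAbs]
  exact_mod_cast Finset.le_sup (f := Int.natAbs) hi

theorem exists_isClopen_separated [T2Space X] (hzero : ZeroDim X) {T : X ≃ₜ X}
    (haper : Aperiodic' T.toEquiv) (x : X) (n : ℕ) :
    ∃ V : Set X, IsClopen V ∧ x ∈ V ∧ Separated T.toEquiv n V := by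
  have key : ∀ i ∈ Finset.Ioo (-n : ℤ) n, ∀ᶠ U in (𝓝 x).smallSets,
      i ≠ 0 → ∀ y ∈ U, (T.toEquiv ^ i) y ∉ U := by
    intro i _
    by_cases hi : i = 0
    · simp [hi]
    obtain ⟨A, B, hA, hB, hxA, hxB, hAB⟩ := t2_separation (haper.zpow_apply_ne x hi).symm
    have hW : A ∩ ⇑(T.toEquiv ^ i) ⁻¹' B ∈ 𝓝 x :=
      (hA.inter (hB.preimage (T.continuous_toEquiv_zpow i))).mem_nhds ⟨hxA, hxB⟩
    filter_upwards [eventually_smallSets_subset.2 hW] with U hU _ y hy hy'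
    exact Set.disjoint_left.1 hAB (hU hy').1 (hU hy).2
  obtain ⟨U, hU, hsep⟩ := eventually_smallSets.1 ((Finset.eventually_all _).2 key)
  obtain ⟨B, hBc, hB⟩ := hzero
  obtain ⟨V, hVB, hxV, hVU⟩ := hB.mem_nhds_iff.1 hU
  refine ⟨V, hBc V hVB, hxV, fun i hi hin => hsep V hVU i ?_ hi⟩
  rw [Finset.mem_Ioo]
  exact abs_lt.1 hin

theorem Sweeping.exists_isClopen_subset_notMem [T2Space X] [CompactSpace X]
    (hzero : ZeroDim X) {T : X ≃ₜ X} (haper : Aperiodic' T.toEquiv) {F : Set X}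
    (h : Sweeping T.toEquiv F) (hF : IsClopen F) (x : X) :
    ∃ G ⊆ F, IsClopen G ∧ Sweeping T.toEquiv G ∧ x ∉ G := by
  obtain ⟨N, hN⟩ := h.exists_bound hF.isOpen
  obtain ⟨V, hV, hxV, hsep⟩ := exists_isClopen_separated hzero haper x (4 * N + 2)
  refine ⟨F \ V, Set.sdiff_subset, hF.diff hV, fun y => ?_, fun hx => hx.2 hxV⟩
  obtain ⟨i, hi, hiF⟩ := hN y
  obtain ⟨j, hj, hjF⟩ := hN ((T.toEquiv ^ (2 * N + 1 : ℤ)) y)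
  rw [Equiv.zpow_apply_zpow_apply] at hjF
  by_cases hiV : (T.toEquiv ^ i) y ∈ V
  · refine ⟨_, hjF, fun hjV => ?_⟩
    rw [abs_le] at hi hj
    refine hsep (j + (2 * N + 1) - i) (by omega) (abs_lt.2 (by push_cast; omega)) _ hiV ?_
    rw [Equiv.zpow_apply_zpow_apply]
    simpa using hjV
  · exact ⟨i, hiF, hiV⟩

theorem IsClopen.separated_union_greedy {T : X ≃ₜ X} {n : ℕ} {G V : Set X}
    (hG : IsClopen G) (hV : IsClopen V) (hGs : Separated T.toEquiv n G)
    (hVs : Separated T.toEquiv n V) :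
    ∃ G', IsClopen G' ∧ G ⊆ G' ∧ G' ⊆ G ∪ V ∧ Separated T.toEquiv n G' ∧
      ∀ y ∈ V, ∃ i : ℤ, (T.toEquiv ^ i) y ∈ G' := by
  set W : Set X := V \ ⋃ i ∈ Finset.Ioo (-n : ℤ) n, ⇑(T.toEquiv ^ i) ⁻¹' G with hW
  have hWG : ∀ y ∈ W, ∀ i : ℤ, |i| < n → (T.toEquiv ^ i) y ∉ G := by
    intro y hy i hi hiG
    exact hy.2 (Set.mem_iUnion₂.2 ⟨i, Finset.mem_Ioo.2 (abs_lt.1 hi), hiG⟩)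
  refine ⟨G ∪ W, hG.union (hV.diff (isClopen_biUnion_finset fun i _ =>
    hG.preimage (T.continuous_toEquiv_zpow i))), Set.subset_union_left,
    Set.union_subset_union_right _ Set.sdiff_subset, ?_, ?_⟩
  · rintro i hi hin y (hy | hy) (hy' | hy')
    · exact hGs i hi hin y hy hy'
    · refine hWG _ hy' (-i) (by rwa [abs_neg]) ?_
      rw [Equiv.zpow_apply_zpow_apply]
      simpa using hy
    · exact hWG y hy i hin hy'
    · exact hVs i hi hin y hy.1 hy'.1
  · intro y hy
    by_cases hyW : y ∈ W
    · exact ⟨0, by simpa using Or.inr hyW⟩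
    · have : y ∈ ⋃ i ∈ Finset.Ioo (-n : ℤ) n, ⇑(T.toEquiv ^ i) ⁻¹' G := by
        by_contra hn
        exact hyW ⟨hy, hn⟩
      obtain ⟨i, _, hi⟩ := Set.mem_iUnion₂.1 this
      exact ⟨i, Or.inl hi⟩

theorem Sweeping.exists_isClopen_subset_separated [T2Space X] [CompactSpace X]
    (hzero : ZeroDim X) {T : X ≃ₜ X} (haper : Aperiodic' T.toEquiv) {F : Set X}
    (h : Sweeping T.toEquiv F) (hF : IsClopen F) (n : ℕ) :
    ∃ G ⊆ F, IsClopen G ∧ Sweeping T.toEquiv G ∧ Separated T.toEquiv n G := by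
  choose V hV hxV hVs using fun x => exists_isClopen_separated hzero haper x n
  obtain ⟨t, -, ht⟩ := hF.isClosed.isCompact.elim_nhds_subcover V
    fun x _ => (hV x).isOpen.mem_nhds (hxV x)
  have greedy : ∀ s : Finset X, ∃ G ⊆ F, IsClopen G ∧ Separated T.toEquiv n G ∧
      ∀ x ∈ s, ∀ y ∈ F ∩ V x, ∃ i : ℤ, (T.toEquiv ^ i) y ∈ G := by
    intro s
    classical
    induction s using Finset.induction_on with
    | empty => exact ⟨∅, Set.empty_subset _, isClopen_empty, fun _ _ _ _ hy => hy.elim, by simp⟩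
    | insert x s _ ih =>
      obtain ⟨G, hGF, hG, hGs, hcov⟩ := ih
      obtain ⟨G', hG', hGG', hG'F, hG's, hcov'⟩ := hG.separated_union_greedy
        (hF.inter (hV x)) hGs ((hVs x).mono Set.inter_subset_right)
      refine ⟨G', hG'F.trans (Set.union_subset hGF Set.inter_subset_left), hG', hG's, ?_⟩
      intro z hz y hy
      rcases Finset.mem_insert.1 hz with rfl | hz
      · exact hcov' y hy
      · obtain ⟨i, hi⟩ := hcov z hz y hy
        exact ⟨i, hGG' hi⟩
  obtain ⟨G, hGF, hG, hGs, hcov⟩ := greedy t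
  refine ⟨G, hGF, hG, fun y => ?_, hGs⟩
  obtain ⟨i, hi⟩ := h y
  obtain ⟨x, hx, hxV'⟩ := Set.mem_iUnion₂.1 (ht hi)
  obtain ⟨j, hj⟩ := hcov x hx _ ⟨hi, hxV'⟩
  exact ⟨j + i, by rwa [Equiv.zpow_apply_zpow_apply] at hj⟩

theorem Sweeping.exists_markerSet [CompactSpace X] {T : X ≃ₜ X} {F : Set X} {a : ℕ}
    (h : Sweeping T.toEquiv F) (hF : IsOpen F) (hs : Separated T.toEquiv a F) :
    ∃ b, a ≤ b ∧ MarkerSet T.toEquiv F a b := by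
  obtain ⟨N, hN⟩ := h.exists_bound hF
  have visit : ∀ (x : X) (m : ℤ), ∃ j, m - N ≤ j ∧ j ≤ m + N ∧ (T.toEquiv ^ j) x ∈ F := by
    intro x m
    obtain ⟨i, hi, hiF⟩ := hN ((T.toEquiv ^ m) x)
    rw [Equiv.zpow_apply_zpow_apply] at hiF
    rw [abs_le] at hi
    exact ⟨i + m, by omega, by omega, hiF⟩
  refine ⟨max a (2 * N + 1), le_max_left _ _, fun x => ⟨fun M => ?_, fun M => ?_, ?_⟩⟩
  · obtain ⟨j, hj, -, hjF⟩ := visit x (M + N + 1)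
    exact ⟨j, by omega, hjF⟩
  · obtain ⟨j, -, hj, hjF⟩ := visit x (M - N - 1)
    exact ⟨j, by omega, hjF⟩
  · intro m n hmn hm hn hgap
    constructor
    · by_contra hlt
      refine hs (n - m) (by omega) (abs_lt.2 (by omega)) _ hm ?_
      rw [Equiv.zpow_apply_zpow_apply]
      simpa using hn
    · by_contra hlt
      obtain ⟨j, hj, hj', hjF⟩ := visit x (m + N + 1)
      exact hgap j (by omega) (by push_cast at hlt; omega) hjF

theorem Homeomorph.isMeagre_orbit_of_isNowhereDense {T : X ≃ₜ X} {C : Set X}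
    (hC : IsNowhereDense C) : IsMeagre {x : X | ∃ n : ℤ, (T.toEquiv ^ n) x ∈ C} := by
  rw [Set.ofPred_exists]
  refine isMeagre_iUnion fun n => ?_
  let S : X ≃ₜ X :=
    { T.toEquiv ^ n with
      continuous_toFun := T.continuous_toEquiv_zpow n
      continuous_invFun := by
        have := T.continuous_toEquiv_zpow (-n)
        rw [zpow_neg] at this
        exact this }
  exact hC.isMeagre.preimage_of_isOpenMap S.continuous S.isOpenMap

end Markers

theorem stmt_7 {X : Type*} [MetricSpace X] [CompactSpace X] [Nonempty X] (T : X ≃ₜ X)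
    (hzero : ZeroDim X) (haper : Aperiodic' T.toEquiv) :
    ∃ (F : ℕ → Set X) (a b : ℕ → ℕ),
      (∀ k, IsClopen (F k)) ∧ (∀ k, F (k + 1) ⊆ F k) ∧
      (∀ k, 0 < a k) ∧ (∀ k, a k ≤ b k) ∧
      Tendsto a atTop atTop ∧
      (∀ k, MarkerSet T.toEquiv (F k) (a k) (b k)) ∧
      IsMeagre {x : X | ∃ n : ℤ, (T.toEquiv ^ n) x ∈ ⋂ k, F k} := by
  have step : ∀ (k : ℕ) (F : {F : Set X // IsClopen F ∧ Sweeping T.toEquiv F}),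
      ∃ G : {F : Set X // IsClopen F ∧ Sweeping T.toEquiv F},
        G.1 ⊆ F.1 ∧ Separated T.toEquiv (k + 1) G.1 ∧ denseSeq X k ∉ G.1 := by
    rintro k ⟨F, hF, hFs⟩
    obtain ⟨F', hF'F, hF', hF's, hk⟩ :=
      hFs.exists_isClopen_subset_notMem hzero haper hF (denseSeq X k)
    obtain ⟨G, hGF', hG, hGs, hsep⟩ :=
      hF's.exists_isClopen_subset_separated hzero haper hF' (k + 1)
    exact ⟨⟨G, hG, hGs⟩, hGF'.trans hF'F, hsep, fun h => hk (hGF' h)⟩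
  choose next hsub hsep hnot using step
  let E : ℕ → {F : Set X // IsClopen F ∧ Sweeping T.toEquiv F} := fun k =>
    Nat.rec ⟨Set.univ, isClopen_univ, fun _ => ⟨0, trivial⟩⟩ next k
  let F : ℕ → Set X := fun k => (E (k + 1)).1
  have hF : ∀ k, IsClopen (F k) := fun k => (E (k + 1)).2.1
  choose b hab hb using fun k =>
    (E (k + 1)).2.2.exists_markerSet (hF k).isOpen (hsep k (E k))
  refine ⟨F, fun k => k + 1, b, hF, fun k => hsub (k + 1) (E (k + 1)), fun k => k.succ_pos,
    hab, tendsto_add_atTop_nat 1, hb, Homeomorph.isMeagre_orbit_of_isNowhereDense ?_⟩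
  rw [(isClosed_iInter fun k => (hF k).isClosed).isNowhereDense_iff,
    interior_eq_empty_iff_dense_compl]
  refine (denseRange_denseSeq X).mono ?_
  rintro _ ⟨k, rfl⟩ hk
  exact hnot k (E k) (Set.mem_iInter.1 hk k)
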